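/- A hypersemigroup (H, ∘) is intra-regular if and only if for every right ideal X of H, every left ideal Y of H, and every bi-ideal B of H, X ∩ B ∩ Y ⊆ (Y*B)*X. -/

import Mathlib

/-- The product of subsets of a hypergroupoid: `A*B := ⋃_{(a,b) ∈ A×B} a∘b`. -/
def hProd {H : Type*} (circ : H → H → Set H) (A B : Set H) : Set H :=
  ⋃ a ∈ A, ⋃ b ∈ B, circ a b

section Quantale

variable {Q : Type*} [Semigroup Q] [CompleteLattice Q] [IsQuantale Q]

theorem le_mul_mul_of_le_top_mul_mul_top {a x y b : Q} (ha : a ≤ ⊤ * a * a * ⊤)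
    (hax : a ≤ x) (hay : a ≤ y) (hab : a ≤ b)
    (hx : x * ⊤ ≤ x) (hy : ⊤ * y ≤ y) (hb : b * ⊤ * b ≤ b) : a ≤ y * b * x :=
  calc
    a ≤ ⊤ * a * a * ⊤ := ha
    _ ≤ ⊤ * (⊤ * a * a * ⊤) * (⊤ * a * a * ⊤) * ⊤ := by gcongr
    _ = (⊤ * ⊤ * a) * (a * (⊤ * ⊤) * a) * (a * (⊤ * ⊤)) := by simp only [mul_assoc]
    _ ≤ (⊤ * y) * (b * ⊤ * b) * (x * ⊤) := by gcongr <;> exact le_top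
    _ ≤ y * b * x := by gcongr

theorem le_top_mul_mul_top_of_le {a : Q}
    (ha : a ≤ (a ⊔ ⊤ * a) * (a ⊔ a * ⊤ * a) * (a ⊔ a * ⊤)) : a ≤ ⊤ * a * a * ⊤ := by
  simp only [mul_assoc]
  have mem (u v : Q) : u * (a * (a * v)) ≤ ⊤ * (a * (a * ⊤)) := by
    gcongr <;> exact le_top
  have expand : a ≤ ⊤ * (a * (a * ⊤)) ⊔ (a * (a * a) ⊔ a * (a * (⊤ * (a * a)))) := by
    refine ha.trans ?_
    simp only [Quantale.mul_sup_distrib, Quantale.sup_mul_distrib, mul_assoc, sup_le_iff]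
    refine ⟨⟨⟨?_, ?_⟩, ?_, ?_⟩, ⟨?_, ?_⟩, ?_, ?_⟩
    · exact le_sup_of_le_right le_sup_left
    · exact le_sup_of_le_left (mem _ _)
    · exact le_sup_of_le_right le_sup_right
    · exact le_sup_of_le_left (mem _ _)
    · exact le_sup_of_le_left (mem _ _)
    · exact le_sup_of_le_left (mem _ _)
    · exact le_sup_of_le_left (by simpa only [mul_assoc] using mem (a * (a * ⊤)) ⊤)
    · exact le_sup_of_le_left (mem _ _)
  have substitute (v : Q) : a * (a * v) ≤ ⊤ * (a * (a * ⊤)) := by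
    refine (mul_le_mul_left expand _).trans ?_
    simp only [Quantale.sup_mul_distrib, mul_assoc, sup_le_iff]
    exact ⟨mem _ _, mem _ _, by simpa only [mul_assoc] using mem (a * (a * ⊤)) (a * v)⟩
  exact expand.trans (sup_le le_rfl (sup_le (substitute _) (substitute _)))

theorem sup_mul_top_le (a : Q) : (a ⊔ a * ⊤) * ⊤ ≤ a ⊔ a * ⊤ := by
  rw [Quantale.sup_mul_distrib, mul_assoc]
  exact le_sup_of_le_right (sup_le le_rfl (by gcongr; exact le_top))

theorem top_mul_sup_le (a : Q) : ⊤ * (a ⊔ ⊤ * a) ≤ a ⊔ ⊤ * a := by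
  rw [Quantale.mul_sup_distrib, ← mul_assoc]
  exact le_sup_of_le_right (sup_le le_rfl (by gcongr; exact le_top))

theorem sup_mul_top_mul_sup_le (a : Q) :
    (a ⊔ a * ⊤ * a) * ⊤ * (a ⊔ a * ⊤ * a) ≤ a ⊔ a * ⊤ * a := by
  have hl : (a ⊔ a * ⊤ * a) * ⊤ ≤ a * ⊤ := by
    rw [Quantale.sup_mul_distrib]
    refine sup_le le_rfl ?_
    simp only [mul_assoc]
    gcongr
    exact le_top
  refine le_sup_of_le_right ((mul_le_mul_left hl _).trans ?_)
  rw [Quantale.mul_sup_distrib]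
  refine sup_le le_rfl ?_
  rw [← mul_assoc, mul_assoc a ⊤ (a * ⊤)]
  gcongr
  exact le_top

theorem le_top_mul_mul_top_iff (a : Q) :
    a ≤ ⊤ * a * a * ⊤ ↔ ∀ x y b : Q, x * ⊤ ≤ x → ⊤ * y ≤ y → b * ⊤ * b ≤ b →
      a ≤ x → a ≤ y → a ≤ b → a ≤ y * b * x :=
  ⟨fun ha _ _ _ hx hy hb hax hay hab =>
    le_mul_mul_of_le_top_mul_mul_top ha hax hay hab hx hy hb,
  fun h => le_top_mul_mul_top_of_le <| h _ _ _ (sup_mul_top_le a) (top_mul_sup_le a)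
    (sup_mul_top_mul_sup_le a) le_sup_left le_sup_left le_sup_left⟩

end Quantale

section Hypersemigroup

variable {H : Type*} {circ : H → H → Set H}

theorem mem_hProd {A B : Set H} {c : H} :
    c ∈ hProd circ A B ↔ ∃ a ∈ A, ∃ b ∈ B, c ∈ circ a b := by
  simp [hProd]

theorem hProd_assoc
    (assoc : ∀ x y z : H, hProd circ {x} (circ y z) = hProd circ (circ x y) {z})
    (A B C : Set H) : hProd circ (hProd circ A B) C = hProd circ A (hProd circ B C) := by
  have key (x y z w : H) :
      (∃ v ∈ circ y z, w ∈ circ x v) ↔ ∃ v ∈ circ x y, w ∈ circ v z := by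
    simpa [mem_hProd] using Set.ext_iff.mp (assoc x y z) w
  ext w
  simp only [mem_hProd]
  constructor
  · rintro ⟨v, ⟨a, ha, b, hb, hv⟩, c, hc, hw⟩
    obtain ⟨u, hu, hwu⟩ := (key a b c w).mpr ⟨v, hv, hw⟩
    exact ⟨a, ha, u, ⟨b, hb, c, hc, hu⟩, hwu⟩
  · rintro ⟨a, ha, v, ⟨b, hb, c, hc, hv⟩, hw⟩
    obtain ⟨u, hu, hwu⟩ := (key a b c w).mp ⟨v, hv, hw⟩
    exact ⟨u, ⟨a, ha, b, hb, hu⟩, c, hc, hwu⟩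

/-- The semigroup of subsets of a hypersemigroup. -/
abbrev hProdSemigroup
    (assoc : ∀ x y z : H, hProd circ {x} (circ y z) = hProd circ (circ x y) {z}) :
    Semigroup (Set H) where
  mul := hProd circ
  mul_assoc := hProd_assoc assoc

theorem isQuantale_hProd
    (assoc : ∀ x y z : H, hProd circ {x} (circ y z) = hProd circ (circ x y) {z}) :
    @IsQuantale (Set H) (hProdSemigroup assoc) _ :=
  letI := hProdSemigroup assoc
  { mul_sSup_distrib := fun A S => by
      change hProd circ A (sSup S) = ⨆ B ∈ S, hProd circ A B
      ext c
      simp only [mem_hProd, Set.iSup_eq_iUnion, Set.mem_iUnion, Set.sSup_eq_sUnion, Set.mem_sUnion]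
      grind
    sSup_mul_distrib := fun S A => by
      change hProd circ (sSup S) A = ⨆ B ∈ S, hProd circ B A
      ext c
      simp only [mem_hProd, Set.iSup_eq_iUnion, Set.mem_iUnion, Set.sSup_eq_sUnion, Set.mem_sUnion]
      grind }

theorem mem_hProd_univ_iff {a : H} :
    a ∈ hProd circ (hProd circ (hProd circ Set.univ {a}) {a}) Set.univ ↔
      ∃ x y : H, a ∈ hProd circ (hProd circ (hProd circ {x} {a}) {a}) {y} := by
  simp only [mem_hProd, Set.mem_singleton_iff, Set.mem_univ]
  grind

end Hypersemigroup

/-- Proposition 24: a hypersemigroup is intra-regular iff `X ∩ B ∩ Y ⊆ (Y*B)*X`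
for every right ideal `X`, every left ideal `Y` and every bi-ideal `B`. -/
theorem intraRegular_iff_biIdeal {H : Type*} [Nonempty H] (circ : H → H → Set H)
    (hcirc : ∀ a b : H, (circ a b).Nonempty)
    (assoc : ∀ x y z : H, hProd circ {x} (circ y z) = hProd circ (circ x y) {z}) :
    (∀ a : H, ∃ x y : H,
        a ∈ hProd circ (hProd circ (hProd circ {x} {a}) {a}) {y}) ↔
      (∀ X Y B : Set H, X.Nonempty → Y.Nonempty → B.Nonempty →
        hProd circ X Set.univ ⊆ X → hProd circ Set.univ Y ⊆ Y →
        hProd circ (hProd circ B Set.univ) B ⊆ B →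
        X ∩ B ∩ Y ⊆ hProd circ (hProd circ Y B) X) := by
  let := hProdSemigroup assoc
  have := isQuantale_hProd assoc
  have intra (a : H) :
      (∃ x y : H, a ∈ hProd circ (hProd circ (hProd circ {x} {a}) {a}) {y}) ↔
        ∀ X Y B : Set H, hProd circ X Set.univ ⊆ X → hProd circ Set.univ Y ⊆ Y →
          hProd circ (hProd circ B Set.univ) B ⊆ B →
          {a} ⊆ X → {a} ⊆ Y → {a} ⊆ B → {a} ⊆ hProd circ (hProd circ Y B) X :=
    (mem_hProd_univ_iff.symm.trans Set.singleton_subset_iff.symm).trans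
      (le_top_mul_mul_top_iff ({a} : Set H))
  simp only [intra, Set.singleton_subset_iff]
  constructor
  · rintro h X Y B - - - hX hY hB a ⟨⟨haX, haB⟩, haY⟩
    exact h a X Y B hX hY hB haX haY haB
  · intro h a X Y B hX hY hB haX haY haB
    exact h X Y B ⟨a, haX⟩ ⟨a, haY⟩ ⟨a, haB⟩ hX hY hB ⟨⟨haX, haB⟩, haY⟩
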